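/- Let (P(t))_{t≥1} be a sequence of m×m doubly stochastic real matrices satisfying the connectivity assumption with constants ζ > 0 and integer B ≥ 1, and set ϑ = (1 − ζ/(4m²))^{−2} and κ = (1 − ζ/(4m²))^{1/B}. Let η > 0, G_l ≥ 0, and let z_{i,t}, g_{i,t} ∈ ℝ^d satisfy z_{i,t+1} = ∑_{j=1}^m P(t)_{ij} z_{j,t} − η g_{i,t} with ‖g_{i,t}‖ ≤ G_l for all i, t, and set z̄_t = (1/m) ∑_{j=1}^m z_{j,t}. Then for every device i and every iteration t ≥ 1, ‖z_{i,t} − z̄_t‖ ≤ ϑ ( κ^{t−1} ∑_{j=1}^m ‖z_{j,0}‖ + mηG_l/(1−κ) + 2ηG_l ). -/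

import Mathlib

open Finset

section Averaging

variable {ι E F : Type*} [Fintype ι] [AddCommGroup E] [Module ℝ E] [AddCommGroup F] [Module ℝ F]

/-- One averaging step: device `i` replaces its vector by the `A i`-weighted sum of all vectors. -/
def averagingStep (A : Matrix ι ι ℝ) (z : ι → E) : ι → E := fun i => ∑ j, A i j • z j

/-- `n` averaging steps, with the matrices `P s, …, P (s + n - 1)`. -/
def evolve (P : ℕ → Matrix ι ι ℝ) : ℕ → ℕ → (ι → E) → ι → E
  | _, 0, z => z
  | s, n + 1, z => evolve P (s + 1) n (averagingStep (P s) z)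

/-- The deviations of the vectors `z i` from their mean. -/
noncomputable def deviation (z : ι → E) : ι → E :=
  fun i => z i - (1 / (Fintype.card ι : ℝ)) • ∑ j, z j

lemma map_averagingStep (L : E →ₗ[ℝ] F) (A : Matrix ι ι ℝ) (z : ι → E) :
    (fun i => L (averagingStep A z i)) = averagingStep A fun i => L (z i) := by
  funext i
  simp [averagingStep]

lemma map_evolve (L : E →ₗ[ℝ] F) (P : ℕ → Matrix ι ι ℝ) (s n : ℕ) (z : ι → E) :
    (fun i => L (evolve P s n z i)) = evolve P s n fun i => L (z i) := by
  induction n generalizing s z with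
  | zero => rfl
  | succ n ih => rw [evolve, ih, map_averagingStep, evolve]

lemma averagingStep_sub_smul (A : Matrix ι ι ℝ) (c : ℝ) (z w : ι → E) :
    averagingStep A (z - c • w) = averagingStep A z - c • averagingStep A w := by
  funext i
  simp [averagingStep, smul_sub, smul_sum, smul_comm c]

lemma evolve_sub_smul (P : ℕ → Matrix ι ι ℝ) (s n : ℕ) (c : ℝ) (z w : ι → E) :
    evolve P s n (z - c • w) = evolve P s n z - c • evolve P s n w := by
  induction n generalizing s z w with
  | zero => rfl
  | succ n ih => simp only [evolve, averagingStep_sub_smul, ih]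

lemma deviation_sub_smul (c : ℝ) (z w : ι → E) :
    deviation (z - c • w) = deviation z - c • deviation w := by
  funext i
  simp only [deviation, Pi.sub_apply, Pi.smul_apply, sum_sub_distrib, ← smul_sum, smul_sub,
    smul_comm c]
  abel

lemma evolve_add (P : ℕ → Matrix ι ι ℝ) (s a b : ℕ) (z : ι → E) :
    evolve P s (a + b) z = evolve P (s + a) b (evolve P s a z) := by
  induction a generalizing s z with
  | zero => simp [evolve]
  | succ a ih => rw [add_right_comm, evolve, ih, evolve, add_right_comm s 1 a, add_assoc s a 1]

lemma evolve_succ (P : ℕ → Matrix ι ι ℝ) (s n : ℕ) (z : ι → E) :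
    evolve P s (n + 1) z = averagingStep (P (s + n)) (evolve P s n z) := by
  rw [evolve_add, evolve, evolve]

end Averaging

lemma exists_cut_of_reflTransGen {α : Type*} {r : α → α → Prop} {S : Set α} {i j : α}
    (h : Relation.ReflTransGen r i j) (hi : i ∈ S) (hj : j ∉ S) :
    ∃ a ∈ S, ∃ b ∉ S, r a b := by
  induction h with
  | refl => exact absurd hi hj
  | @tail b c _ hbc ih =>
    by_cases hb : b ∈ S
    · exact ⟨b, hb, c, hj, hbc⟩
    · exact ih hb

section Variance

variable {ι : Type*} [Fintype ι]

/-- The variance of `x` under the weights `p`. -/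
def weightedVariance (p x : ι → ℝ) : ℝ := ∑ j, p j * x j ^ 2 - (∑ j, p j * x j) ^ 2

/-- The sum of the squared deviations of `x` from its mean. -/
noncomputable def dispersion (x : ι → ℝ) : ℝ := ∑ i, deviation x i ^ 2

lemma two_mul_weightedVariance {p : ι → ℝ} (hp : ∑ j, p j = 1) (x : ι → ℝ) :
    2 * weightedVariance p x = ∑ i, ∑ j, p i * p j * (x i - x j) ^ 2 := by
  have expand : ∀ i j, p i * p j * (x i - x j) ^ 2 =
      (p i * x i ^ 2) * p j + p i * (p j * x j ^ 2) - 2 * ((p i * x i) * (p j * x j)) :=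
    fun i j => by ring
  simp only [expand, sum_add_distrib, sum_sub_distrib, ← mul_sum, ← sum_mul, hp]
  rw [weightedVariance]
  ring

lemma weightedVariance_nonneg {p : ι → ℝ} (h0 : ∀ j, 0 ≤ p j) (hp : ∑ j, p j = 1) (x : ι → ℝ) :
    0 ≤ weightedVariance p x := by
  have h : 0 ≤ ∑ i, ∑ j, p i * p j * (x i - x j) ^ 2 :=
    sum_nonneg fun i _ => sum_nonneg fun j _ =>
      mul_nonneg (mul_nonneg (h0 i) (h0 j)) (sq_nonneg _)
  linarith [two_mul_weightedVariance hp x]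

/-- The part of `v` between the levels `y k` and `y (k + 1)`. -/
def layer (y : ℕ → ℝ) (k : ℕ) (v : ℝ) : ℝ := min v (y (k + 1)) - min v (y k)

lemma sum_sq_layer_sub_le {y : ℕ → ℝ} (hy : Monotone y) (n : ℕ) (u v : ℝ) :
    ∑ k ∈ range n, (layer y k u - layer y k v) ^ 2 ≤ (u - v) ^ 2 := by
  wlog huv : v ≤ u generalizing u v
  · calc _ = ∑ k ∈ range n, (layer y k v - layer y k u) ^ 2 :=
          sum_congr rfl fun _ _ => by ring
      _ ≤ (v - u) ^ 2 := this v u (le_of_not_ge huv)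
      _ = _ := by ring
  have hpos : ∀ k ∈ range n, 0 ≤ layer y k u - layer y k v := by
    intro k _
    have := hy (Nat.le_succ k)
    simp only [layer, Nat.succ_eq_add_one] at *
    grind
  have hsum : ∑ k ∈ range n, (layer y k u - layer y k v) ≤ u - v := by
    rw [sum_sub_distrib]
    simp only [layer, sum_range_sub (fun k => min u (y k)), sum_range_sub (fun k => min v (y k))]
    grind
  calc _ ≤ (∑ k ∈ range n, (layer y k u - layer y k v)) ^ 2 := sum_sq_le_sq_sum_of_nonneg hpos
    _ ≤ _ := pow_le_pow_left₀ (sum_nonneg hpos) hsum 2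

lemma sum_weightedVariance_layer_le {p : ι → ℝ} (h0 : ∀ j, 0 ≤ p j) (hp : ∑ j, p j = 1)
    {y : ℕ → ℝ} (hy : Monotone y) (n : ℕ) (x : ι → ℝ) :
    ∑ k ∈ range n, weightedVariance p (fun j => layer y k (x j)) ≤ weightedVariance p x := by
  have key : ∑ k ∈ range n, 2 * weightedVariance p (fun j => layer y k (x j)) ≤
      2 * weightedVariance p x := by
    simp only [two_mul_weightedVariance hp]
    rw [sum_comm]
    refine sum_le_sum fun i _ => ?_
    rw [sum_comm]
    refine sum_le_sum fun j _ => ?_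
    rw [← mul_sum]
    exact mul_le_mul_of_nonneg_left (sum_sq_layer_sub_le hy n _ _) (mul_nonneg (h0 i) (h0 j))
  rw [← mul_sum] at key
  linarith

lemma le_weightedVariance_of_cut {p : ι → ℝ} (h0 : ∀ j, 0 ≤ p j) (hp : ∑ j, p j = 1)
    {S : Set ι} {a b : ι} (ha : a ∈ S) (hb : b ∉ S) {ζ : ℝ} (hpa : ζ ≤ p a) (hpb : ζ ≤ p b)
    {c : ℝ} {x : ι → ℝ} (hin : ∀ i ∈ S, x i = 0) (hout : ∀ i ∉ S, x i = c) :
    ζ / 2 * c ^ 2 ≤ weightedVariance p x := by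
  classical
  set q := ∑ j, if j ∈ S then 0 else p j with hq
  set r := ∑ j, if j ∈ S then p j else 0 with hr
  have hqr : r + q = 1 := by
    rw [hq, hr, ← sum_add_distrib, ← hp]
    exact sum_congr rfl fun j _ => by split_ifs <;> simp
  have hζq : ζ ≤ q := hpb.trans <| by
    have := single_le_sum (f := fun j => if j ∈ S then 0 else p j)
      (fun j _ => by split_ifs; exacts [le_rfl, h0 j]) (mem_univ b)
    simpa [hb] using this
  have hζr : ζ ≤ r := hpa.trans <| by
    have := single_le_sum (f := fun j => if j ∈ S then p j else 0)
      (fun j _ => by split_ifs; exacts [h0 j, le_rfl]) (mem_univ a)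
    simpa [ha] using this
  have h1 : ∑ j, p j * x j = c * q := by
    rw [hq, mul_sum]
    refine sum_congr rfl fun j _ => ?_
    split_ifs with h
    · simp [hin j h]
    · rw [hout j h, mul_comm]
  have h2 : ∑ j, p j * x j ^ 2 = c ^ 2 * q := by
    rw [hq, mul_sum]
    refine sum_congr rfl fun j _ => ?_
    split_ifs with h
    · simp [hin j h]
    · rw [hout j h, mul_comm]
  have hrq : ζ / 2 ≤ q * (1 - q) := by
    have hq0 : 0 ≤ q := sum_nonneg fun j _ => by split_ifs; exacts [le_rfl, h0 j]
    have hr0 : 0 ≤ r := sum_nonneg fun j _ => by split_ifs; exacts [h0 j, le_rfl]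
    have : r = 1 - q := by linarith
    rcases le_total q (1 / 2) with h | h <;> nlinarith
  calc ζ / 2 * c ^ 2 ≤ q * (1 - q) * c ^ 2 := mul_le_mul_of_nonneg_right hrq (sq_nonneg c)
    _ = weightedVariance p x := by rw [weightedVariance, h1, h2]; ring

lemma dispersion_eq_sub [Nonempty ι] (x : ι → ℝ) (a : ℝ) :
    dispersion x = ∑ i, (x i - a) ^ 2 - (∑ i, (x i - a)) ^ 2 / Fintype.card ι := by
  have hc : (Fintype.card ι : ℝ) ≠ 0 := Nat.cast_ne_zero.2 Fintype.card_ne_zero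
  simp only [dispersion, deviation, sub_sq, sum_add_distrib, sum_sub_distrib, ← mul_sum,
    ← sum_mul, sum_const, card_univ, nsmul_eq_mul, smul_eq_mul]
  field_simp
  ring

lemma dispersion_nonneg (x : ι → ℝ) : 0 ≤ dispersion x := sum_nonneg fun _ _ => sq_nonneg _

lemma dispersion_le_sum_sq_sub [Nonempty ι] (x : ι → ℝ) (a : ℝ) :
    dispersion x ≤ ∑ i, (x i - a) ^ 2 := by
  rw [dispersion_eq_sub x a]
  have : 0 ≤ (∑ i, (x i - a)) ^ 2 / Fintype.card ι := by positivity
  linarith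

lemma dispersion_averagingStep [Nonempty ι] {A : Matrix ι ι ℝ} (hcol : ∀ j, ∑ i, A i j = 1)
    (x : ι → ℝ) :
    dispersion (averagingStep A x) + ∑ k, weightedVariance (A k) x = dispersion x := by
  rw [dispersion_eq_sub _ 0, dispersion_eq_sub x 0]
  have h : ∀ f : ι → ℝ, ∑ i, ∑ j, A i j * f j = ∑ j, f j := fun f => by
    rw [sum_comm]
    exact sum_congr rfl fun j _ => by rw [← sum_mul, hcol, one_mul]
  simp only [averagingStep, weightedVariance, sub_zero, smul_eq_mul, sum_sub_distrib, h]
  ring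

lemma dispersion_evolve [Nonempty ι] {P : ℕ → Matrix ι ι ℝ}
    (hcol : ∀ t, ∀ j, ∑ i, P t i j = 1) (s n : ℕ) (x : ι → ℝ) :
    dispersion (evolve P s n x) +
      ∑ t ∈ range n, ∑ k, weightedVariance (P (s + t) k) (evolve P s t x) = dispersion x := by
  induction n with
  | zero => simp [evolve]
  | succ n ih =>
    rw [evolve_succ, sum_range_succ, ← ih, ← dispersion_averagingStep (hcol (s + n)) (evolve P s n x)]
    ring

lemma dispersion_evolve_le [Nonempty ι] {P : ℕ → Matrix ι ι ℝ}
    (hnonneg : ∀ t, ∀ i j, 0 ≤ P t i j) (hrow : ∀ t, ∀ i, ∑ j, P t i j = 1)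
    (hcol : ∀ t, ∀ j, ∑ i, P t i j = 1) (s n : ℕ) (x : ι → ℝ) :
    dispersion (evolve P s n x) ≤ dispersion x := by
  have h : 0 ≤ ∑ t ∈ range n, ∑ k, weightedVariance (P (s + t) k) (evolve P s t x) :=
    sum_nonneg fun t _ => sum_nonneg fun k _ =>
      weightedVariance_nonneg (hnonneg _ k) (hrow _ k) _
  linarith [dispersion_evolve hcol s n x]

/-- If no positive entry links `S` to its complement before time `s + n`, levels separating the
values on `S` from those on its complement keep doing so. -/
lemma separated_evolve {P : ℕ → Matrix ι ι ℝ}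
    (hnonneg : ∀ t, ∀ i j, 0 ≤ P t i j) (hrow : ∀ t, ∀ i, ∑ j, P t i j = 1)
    {S : Set ι} {lo hi : ℝ} {s n : ℕ} {x : ι → ℝ}
    (hS : ∀ t < n, ∀ a ∈ S, ∀ b ∉ S, P (s + t) a b = 0 ∧ P (s + t) b a = 0)
    (hin : ∀ i ∈ S, x i ≤ lo) (hout : ∀ i ∉ S, hi ≤ x i) :
    (∀ i ∈ S, evolve P s n x i ≤ lo) ∧ ∀ i ∉ S, hi ≤ evolve P s n x i := by
  induction n with
  | zero => exact ⟨hin, hout⟩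
  | succ n ih =>
    obtain ⟨h1, h2⟩ := ih fun t ht => hS t (ht.trans n.lt_succ_self)
    have h3 := hS n n.lt_succ_self
    simp only [evolve_succ, averagingStep, smul_eq_mul]
    constructor
    · intro i hi
      calc _ ≤ ∑ j, P (s + n) i j * lo := sum_le_sum fun j _ => by
            by_cases hj : j ∈ S
            · exact mul_le_mul_of_nonneg_left (h1 j hj) (hnonneg _ _ _)
            · simp [(h3 i hi j hj).1]
        _ = lo := by rw [← sum_mul, hrow, one_mul]
    · intro i hi'
      calc hi = ∑ j, P (s + n) i j * hi := by rw [← sum_mul, hrow, one_mul]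
        _ ≤ _ := sum_le_sum fun j _ => by
            by_cases hj : j ∈ S
            · simp [(h3 j hj i hi').2]
            · exact mul_le_mul_of_nonneg_left (h2 j hj) (hnonneg _ _ _)

/-- A layer that separates the initial values loses variance over a connected window. -/
lemma le_sum_weightedVariance_layer {P : ℕ → Matrix ι ι ℝ} {ζ : ℝ}
    (hnonneg : ∀ t, ∀ i j, 0 ≤ P t i j) (hrow : ∀ t, ∀ i, ∑ j, P t i j = 1)
    (hdiag : ∀ t, ∀ i, ζ ≤ P t i i)
    (hedge : ∀ t, ∀ i j : ι, i ≠ j → (0 < P t i j ∨ 0 < P t j i) → ζ ≤ P t i j)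
    {s n : ℕ} (hconn : ∀ i j : ι, Relation.ReflTransGen
      (fun a b => a ≠ b ∧ ∃ t < n, 0 < P (s + t) a b ∨ 0 < P (s + t) b a) i j)
    {y : ℕ → ℝ} (hy : Monotone y) {k : ℕ} {x : ι → ℝ}
    (hgap : ∀ i, x i ≤ y k ∨ y (k + 1) ≤ x i) {i j : ι} (hi : x i = y k) (hj : x j = y (k + 1)) :
    ζ / 2 * (y (k + 1) - y k) ^ 2 ≤
      ∑ t ∈ range n, ∑ l, weightedVariance (P (s + t) l)
        (fun j => layer y k (evolve P s t x j)) := by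
  classical
  have hpos : ∀ t ∈ range n, ∀ l ∈ univ, 0 ≤ weightedVariance (P (s + t) l)
      (fun j => layer y k (evolve P s t x j)) := fun t _ l _ =>
    weightedVariance_nonneg (hnonneg _ l) (hrow _ l) _
  rcases (hy k.le_succ).eq_or_lt with h | h
  · rw [Nat.succ_eq_add_one] at h
    rw [h, sub_self]
    simpa using sum_nonneg fun t ht => sum_nonneg (hpos t ht)
  set S : Set ι := {i | x i ≤ y k}
  have hiS : i ∈ S := hi.le
  have hjS : j ∉ S := fun hj' : x j ≤ y k => (hj ▸ hj').not_gt h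
  have hcross : ∃ t, t < n ∧ ∃ a ∈ S, ∃ b ∉ S, 0 < P (s + t) a b ∨ 0 < P (s + t) b a := by
    obtain ⟨a, ha, b, hb, -, t, ht, hab⟩ := exists_cut_of_reflTransGen (hconn i j) hiS hjS
    exact ⟨t, ht, a, ha, b, hb, hab⟩
  obtain ⟨ht, a, ha, b, hb, hab⟩ := Nat.find_spec hcross
  set t := Nat.find hcross with htdef
  have hS : ∀ t' < t, ∀ a ∈ S, ∀ b ∉ S, P (s + t') a b = 0 ∧ P (s + t') b a = 0 := by
    intro t' ht' a ha b hb
    have := Nat.find_min hcross ht'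
    push Not at this
    obtain ⟨h1, h2⟩ := this (ht'.trans ht) a ha b hb
    exact ⟨h1.antisymm (hnonneg _ _ _), h2.antisymm (hnonneg _ _ _)⟩
  obtain ⟨hlo, hhi⟩ := separated_evolve (lo := y k) (hi := y (k + 1)) hnonneg hrow hS
    (fun i hi => hi) (fun i hi => (hgap i).resolve_left hi)
  have hne : a ≠ b := fun hab => hb (hab ▸ ha)
  calc _ ≤ weightedVariance (P (s + t) a) (fun j => layer y k (evolve P s t x j)) :=
        le_weightedVariance_of_cut (hnonneg _ a) (hrow _ a) ha hb (hdiag _ a)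
          (hedge _ a b hne hab)
          (fun l hl => by
            have := hlo l hl
            rw [layer, min_eq_left this, min_eq_left (this.trans h.le), sub_self])
          (fun l hl => by
            have := hhi l hl
            rw [layer, min_eq_right this, min_eq_right (h.le.trans this)])
    _ ≤ _ := single_le_sum (hpos t (mem_range.2 ht)) (mem_univ a)
    _ ≤ _ := single_le_sum (f := fun t => ∑ l, weightedVariance (P (s + t) l)
        (fun j => layer y k (evolve P s t x j)))
        (fun t ht => sum_nonneg (hpos t ht)) (mem_range.2 ht)

end Variance

section Contraction

variable {m : ℕ} {P : ℕ → Matrix (Fin m) (Fin m) ℝ} {ζ : ℝ}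

/-- The dispersion contracts by a fixed factor over a connected window. -/
lemma dispersion_evolve_le_of_connected (hm : 1 ≤ m)
    (hζ : 0 < ζ) (hnonneg : ∀ t, ∀ i j, 0 ≤ P t i j) (hrow : ∀ t, ∀ i, ∑ j, P t i j = 1)
    (hcol : ∀ t, ∀ j, ∑ i, P t i j = 1) (hdiag : ∀ t, ∀ i, ζ ≤ P t i i)
    (hedge : ∀ t, ∀ i j : Fin m, i ≠ j → (0 < P t i j ∨ 0 < P t j i) → ζ ≤ P t i j)
    {s n : ℕ} (hconn : ∀ i j : Fin m, Relation.ReflTransGen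
      (fun a b => a ≠ b ∧ ∃ t < n, 0 < P (s + t) a b ∨ 0 < P (s + t) b a) i j)
    (x : Fin m → ℝ) :
    dispersion (evolve P s n x) ≤ (1 - ζ / (2 * (m : ℝ) ^ 2)) * dispersion x := by
  have : Nonempty (Fin m) := ⟨⟨0, hm⟩⟩
  let e : ℕ → Fin m := fun k => ⟨min k (m - 1), by omega⟩
  let y : ℕ → ℝ := fun k => x (Tuple.sort x (e k))
  have hsort : Monotone (x ∘ Tuple.sort x) := Tuple.monotone_sort x
  have hy : Monotone y := fun k l hkl => hsort (Fin.mk_le_mk.2 (min_le_min_right _ hkl))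
  have hx : ∀ i, ∃ l < m, x i = y l := fun i => by
    refine ⟨(Tuple.sort x).symm i, Fin.is_lt _, ?_⟩
    have : e ((Tuple.sort x).symm i) = (Tuple.sort x).symm i :=
      Fin.ext (min_eq_left (by have := ((Tuple.sort x).symm i).is_lt; omega))
    simp only [y, this, Equiv.apply_symm_apply]
  have hgap : ∀ k i, x i ≤ y k ∨ y (k + 1) ≤ x i := fun k i => by
    obtain ⟨l, -, hl⟩ := hx i
    rw [hl]
    exact (le_or_gt l k).imp (fun h => hy h) fun h => hy h
  have hrange : dispersion x ≤ (m : ℝ) * (y (m - 1) - y 0) ^ 2 := by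
    calc dispersion x ≤ ∑ i, (x i - y 0) ^ 2 := dispersion_le_sum_sq_sub x (y 0)
      _ ≤ ∑ _i : Fin m, (y (m - 1) - y 0) ^ 2 := sum_le_sum fun i _ => by
          obtain ⟨l, hl, hxl⟩ := hx i
          rw [hxl]
          exact pow_le_pow_left₀ (sub_nonneg.2 (hy (Nat.zero_le _)))
            (sub_le_sub_right (hy (by omega)) _) 2
      _ = _ := by simp
  have hgaps : (y (m - 1) - y 0) ^ 2 ≤ m * ∑ k ∈ range (m - 1), (y (k + 1) - y k) ^ 2 := by
    rw [← sum_range_sub]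
    refine sq_sum_le_card_mul_sum_sq.trans ?_
    refine mul_le_mul_of_nonneg_right ?_ (sum_nonneg fun _ _ => sq_nonneg _)
    simp
  have hdrop : ζ / 2 * ∑ k ∈ range (m - 1), (y (k + 1) - y k) ^ 2 ≤
      ∑ t ∈ range n, ∑ l, weightedVariance (P (s + t) l) (evolve P s t x) := by
    rw [mul_sum]
    calc _ ≤ ∑ k ∈ range (m - 1), ∑ t ∈ range n, ∑ l, weightedVariance (P (s + t) l)
          (fun j => layer y k (evolve P s t x j)) := sum_le_sum fun k _ =>
            le_sum_weightedVariance_layer hnonneg hrow hdiag hedge hconn hy (hgap k) rfl rfl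
      _ = ∑ t ∈ range n, ∑ l, ∑ k ∈ range (m - 1), weightedVariance (P (s + t) l)
          (fun j => layer y k (evolve P s t x j)) := by
            rw [sum_comm]
            exact sum_congr rfl fun t _ => sum_comm
      _ ≤ _ := sum_le_sum fun t _ => sum_le_sum fun l _ =>
            sum_weightedVariance_layer_le (hnonneg _ l) (hrow _ l) hy _ _
  have hm0 : (0 : ℝ) < m := by exact_mod_cast hm
  have htot : dispersion x ≤ (m : ℝ) ^ 2 * ∑ k ∈ range (m - 1), (y (k + 1) - y k) ^ 2 := by
    calc _ ≤ _ := hrange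
      _ ≤ (m : ℝ) * (m * ∑ k ∈ range (m - 1), (y (k + 1) - y k) ^ 2) := by gcongr
      _ = _ := by ring
  have hfrac : ζ / (2 * (m : ℝ) ^ 2) * dispersion x ≤
      ζ / 2 * ∑ k ∈ range (m - 1), (y (k + 1) - y k) ^ 2 := by
    calc _ ≤ ζ / (2 * (m : ℝ) ^ 2) *
          ((m : ℝ) ^ 2 * ∑ k ∈ range (m - 1), (y (k + 1) - y k) ^ 2) := by gcongr
      _ = _ := by field_simp
  linarith [dispersion_evolve hcol s n x]

/-- Over any stretch of time that contains `q` consecutive connected windows, the dispersion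
contracts by the `q`-th power of the factor for one window. -/
lemma dispersion_evolve_le_pow (hm : 1 ≤ m)
    (hζ : 0 < ζ) (hnonneg : ∀ t, ∀ i j, 0 ≤ P t i j) (hrow : ∀ t, ∀ i, ∑ j, P t i j = 1)
    (hcol : ∀ t, ∀ j, ∑ i, P t i j = 1) (hdiag : ∀ t, ∀ i, ζ ≤ P t i i)
    (hedge : ∀ t, ∀ i j : Fin m, i ≠ j → (0 < P t i j ∨ 0 < P t j i) → ζ ≤ P t i j)
    {B : ℕ} (hconn : ∀ k : ℕ, ∀ i j : Fin m, Relation.ReflTransGen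
      (fun a b => a ≠ b ∧ ∃ t, k * B + 1 ≤ t ∧ t ≤ (k + 1) * B ∧
        (0 < P t a b ∨ 0 < P t b a)) i j)
    (hγ : 0 ≤ 1 - ζ / (2 * (m : ℝ) ^ 2)) {s n k q : ℕ} (hs : s ≤ k * B + 1)
    (hn : k * B + 1 + q * B ≤ s + n) (x : Fin m → ℝ) :
    dispersion (evolve P s n x) ≤ (1 - ζ / (2 * (m : ℝ) ^ 2)) ^ q * dispersion x := by
  have : Nonempty (Fin m) := ⟨⟨0, hm⟩⟩
  have windows : ∀ q (x : Fin m → ℝ), dispersion (evolve P (k * B + 1) (q * B) x) ≤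
      (1 - ζ / (2 * (m : ℝ) ^ 2)) ^ q * dispersion x := by
    intro q x
    induction q with
    | zero => simp [evolve]
    | succ q ih =>
      have hconn' : ∀ i j : Fin m, Relation.ReflTransGen (fun a b => a ≠ b ∧ ∃ t < B,
          0 < P (k * B + 1 + q * B + t) a b ∨ 0 < P (k * B + 1 + q * B + t) b a) i j := by
        intro i j
        refine Relation.ReflTransGen.mono ?_ _ _ (hconn (k + q) i j)
        rintro a b ⟨hab, t, h1, h2, h3⟩
        simp only [add_mul, one_mul] at h1 h2
        refine ⟨hab, t - (k * B + 1 + q * B), by omega, ?_⟩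
        rwa [Nat.add_sub_cancel' (by omega)]
      rw [add_mul, one_mul, evolve_add, pow_succ', mul_assoc]
      exact (dispersion_evolve_le_of_connected hm hζ hnonneg hrow hcol hdiag hedge hconn' _).trans
        (mul_le_mul_of_nonneg_left ih hγ)
  obtain ⟨a, ha⟩ := Nat.exists_eq_add_of_le hs
  obtain ⟨b, hb⟩ := Nat.exists_eq_add_of_le hn
  obtain rfl : n = a + (q * B + b) := by omega
  rw [evolve_add, ← ha, evolve_add]
  calc _ ≤ dispersion (evolve P (k * B + 1) (q * B) (evolve P s a x)) :=
        dispersion_evolve_le hnonneg hrow hcol _ _ _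
    _ ≤ _ := windows q _
    _ ≤ _ := mul_le_mul_of_nonneg_left (dispersion_evolve_le hnonneg hrow hcol s a x)
        (pow_nonneg hγ q)

end Contraction

section DeviationNorm

variable {ι : Type*} [Fintype ι] {d : ℕ}

/-- The `ℓ²` norm of the deviations from the mean. -/
noncomputable def deviationNorm (z : ι → EuclideanSpace ℝ (Fin d)) : ℝ :=
  ‖WithLp.toLp 2 (deviation z)‖

lemma deviationNorm_nonneg (z : ι → EuclideanSpace ℝ (Fin d)) : 0 ≤ deviationNorm z :=
  norm_nonneg _

lemma deviationNorm_sub_smul_le {c : ℝ} (hc : 0 ≤ c) (z w : ι → EuclideanSpace ℝ (Fin d)) :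
    deviationNorm (z - c • w) ≤ deviationNorm z + c * deviationNorm w := by
  rw [deviationNorm, deviation_sub_smul, WithLp.toLp_sub, WithLp.toLp_smul]
  refine (norm_sub_le _ _).trans_eq ?_
  rw [norm_smul, Real.norm_of_nonneg hc, deviationNorm, deviationNorm]

lemma deviationNorm_sq (z : ι → EuclideanSpace ℝ (Fin d)) :
    deviationNorm z ^ 2 = ∑ c, dispersion fun i => z i c := by
  rw [deviationNorm, PiLp.norm_sq_eq_of_L2]
  simp only [EuclideanSpace.real_norm_sq_eq, dispersion]
  rw [sum_comm]
  simp [deviation]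

lemma deviationNorm_le_sum_norm [Nonempty ι] (z : ι → EuclideanSpace ℝ (Fin d)) :
    deviationNorm z ≤ ∑ i, ‖z i‖ := by
  refine (sq_le_sq₀ (deviationNorm_nonneg _) (sum_nonneg fun _ _ => norm_nonneg _)).1 ?_
  calc deviationNorm z ^ 2 = ∑ c, dispersion fun i => z i c := deviationNorm_sq z
    _ ≤ ∑ c, ∑ i, (z i c - 0) ^ 2 := sum_le_sum fun c _ => dispersion_le_sum_sq_sub _ 0
    _ = ∑ i, ‖z i‖ ^ 2 := by
        rw [sum_comm]
        simp only [EuclideanSpace.real_norm_sq_eq, sub_zero]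
    _ ≤ _ := sum_sq_le_sq_sum_of_nonneg fun _ _ => norm_nonneg _

lemma deviationNorm_evolve_le {P : ℕ → Matrix ι ι ℝ} {s n : ℕ} {c : ℝ} (hc : 0 ≤ c)
    (h : ∀ x : ι → ℝ, dispersion (evolve P s n x) ≤ c ^ 2 * dispersion x)
    (z : ι → EuclideanSpace ℝ (Fin d)) :
    deviationNorm (evolve P s n z) ≤ c * deviationNorm z := by
  refine (sq_le_sq₀ (deviationNorm_nonneg _) (mul_nonneg hc (deviationNorm_nonneg z))).1 ?_
  rw [mul_pow, deviationNorm_sq, deviationNorm_sq, mul_sum]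
  refine sum_le_sum fun k _ => ?_
  have := map_evolve (EuclideanSpace.proj (𝕜 := ℝ) k).toLinearMap P s n z
  exact (congrArg dispersion this).trans_le (h _)

/-- A perturbed averaging recursion deviates by at most the deviation of the unperturbed one plus
a geometric sum of the perturbations. -/
lemma deviationNorm_le_of_recursion {P : ℕ → Matrix ι ι ℝ}
    {z g : ℕ → ι → EuclideanSpace ℝ (Fin d)} {η M C κ : ℝ} (hη : 0 ≤ η) (hC : 0 ≤ C) (hκ : 0 ≤ κ)
    (hrec : ∀ t, z (t + 1) = averagingStep (P t) (z t) - η • g t)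
    (hg : ∀ t, deviationNorm (g t) ≤ M)
    (hdecay : ∀ s n (w : ι → EuclideanSpace ℝ (Fin d)),
      deviationNorm (evolve P (s + 1) n w) ≤ C * κ ^ n * deviationNorm w) (s n : ℕ) :
    deviationNorm (z (s + n)) ≤
      deviationNorm (evolve P s n (z s)) + η * M * C * ∑ k ∈ range n, κ ^ k := by
  induction n generalizing s with
  | zero => simp [evolve]
  | succ n ih =>
    have hstep : deviationNorm (evolve P (s + 1) n (z (s + 1))) ≤
        deviationNorm (evolve P s (n + 1) (z s)) + η * (C * κ ^ n * M) := by
      rw [hrec, evolve_sub_smul, evolve]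
      refine (deviationNorm_sub_smul_le hη _ _).trans ?_
      gcongr
      exact (hdecay s n _).trans (by gcongr; exact hg s)
    rw [sum_range_succ, add_comm n 1, ← add_assoc, add_comm 1 n]
    linarith [ih (s + 1)]

end DeviationNorm


/-- Consensus Lemma 2 of the paper.  Under the connectivity
assumption on the doubly stochastic matrices `P t` (diagonal entries `≥ ζ`,
entries `≥ ζ` on edges of `E_t = {{i,j} : P t i j > 0}`, and strong connectivity
of the union of the edge sets over each window of `B` consecutive iterations),
set `ϑ = (1 − ζ/(4m²))⁻²` and `κ = (1 − ζ/(4m²))^(1/B)`.  If the iterates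
satisfy `z i (t+1) = ∑ j, P t i j • z j t − η • g i t` with `‖g i t‖ ≤ G_l` and
`z̄ t = (1/m) ∑ j, z j t`, then for every device `i` and every iteration `t ≥ 1`,
`‖z i t − z̄ t‖ ≤ ϑ (κ^(t−1) ∑ j, ‖z j 0‖ + mηG_l/(1−κ) + 2ηG_l)`. -/
theorem consensus_bound_of_connectivity
    {m d : ℕ} (hm : 1 ≤ m)
    (P : ℕ → Matrix (Fin m) (Fin m) ℝ)
    (ζ : ℝ) (hζ : 0 < ζ) (B : ℕ) (hB : 1 ≤ B)
    (hnonneg : ∀ t, ∀ i j, 0 ≤ P t i j)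
    (hrow : ∀ t, ∀ i, ∑ j, P t i j = 1)
    (hcol : ∀ t, ∀ j, ∑ i, P t i j = 1)
    (hdiag : ∀ t, ∀ i, ζ ≤ P t i i)
    (hedge : ∀ t, ∀ i j : Fin m, i ≠ j →
      (0 < P t i j ∨ 0 < P t j i) → ζ ≤ P t i j)
    (hconn : ∀ k : ℕ, ∀ i j : Fin m,
      Relation.ReflTransGen
        (fun a b => a ≠ b ∧ ∃ t, k * B + 1 ≤ t ∧ t ≤ (k + 1) * B ∧
          (0 < P t a b ∨ 0 < P t b a)) i j)
    (ϑ κ : ℝ)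
    (hϑ : ϑ = ((1 - ζ / (4 * (m : ℝ) ^ 2))⁻¹) ^ 2)
    (hκ : κ = (1 - ζ / (4 * (m : ℝ) ^ 2)) ^ ((1 : ℝ) / (B : ℝ)))
    (η G_l : ℝ) (hη : 0 < η) (hG : 0 ≤ G_l)
    (z g : Fin m → ℕ → EuclideanSpace ℝ (Fin d))
    (hrec : ∀ i t, z i (t + 1) = (∑ j, P t i j • z j t) - η • g i t)
    (hgbound : ∀ i t, ‖g i t‖ ≤ G_l) :
    ∀ (i : Fin m) (t : ℕ), 1 ≤ t →
      ‖z i t - (1 / (m : ℝ)) • ∑ j, z j t‖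
        ≤ ϑ * (κ ^ (t - 1) * (∑ j, ‖z j 0‖)
            + (m : ℝ) * η * G_l / (1 - κ) + 2 * η * G_l) := by
  have : Nonempty (Fin m) := ⟨⟨0, hm⟩⟩
  have hm1 : (1 : ℝ) ≤ m := by exact_mod_cast hm
  have hζ1 : ζ ≤ 1 := (hdiag 0 ⟨0, hm⟩).trans <|
    (single_le_sum (fun j _ => hnonneg 0 ⟨0, hm⟩ j) (mem_univ _)).trans_eq (hrow 0 _)
  set β : ℝ := 1 - ζ / (4 * (m : ℝ) ^ 2) with hβ
  have hfrac : ζ / (4 * (m : ℝ) ^ 2) ≤ 1 / 4 := by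
    rw [div_le_div_iff₀ (by positivity) (by norm_num)]
    nlinarith
  have hfrac0 : 0 < ζ / (4 * (m : ℝ) ^ 2) := by positivity
  have hβ0 : 0 < β := by linarith
  have hβ1 : β < 1 := by linarith
  have hhalf : ζ / (2 * (m : ℝ) ^ 2) = 2 * (ζ / (4 * (m : ℝ) ^ 2)) := by field_simp; norm_num
  have hγ0 : 0 ≤ 1 - ζ / (2 * (m : ℝ) ^ 2) := by linarith
  have hγβ : 1 - ζ / (2 * (m : ℝ) ^ 2) ≤ β ^ 2 := by
    rw [hhalf, hβ]
    nlinarith [sq_nonneg (ζ / (4 * (m : ℝ) ^ 2))]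
  have hκ0 : 0 < κ := hκ ▸ Real.rpow_pos_of_pos hβ0 _
  have hκ1 : κ < 1 := hκ ▸ Real.rpow_lt_one hβ0.le hβ1 (by positivity)
  have hκB : κ ^ B = β := by
    rw [hκ, one_div, Real.rpow_inv_natCast_pow hβ0.le (by omega)]
  have hϑ1 : 1 ≤ ϑ := hϑ ▸ one_le_pow₀ ((one_le_inv₀ hβ0).2 hβ1.le)
  have hpow : ∀ q n : ℕ, n ≤ (q + 2) * B → β ^ q ≤ ϑ * κ ^ n := by
    intro q n h
    calc β ^ q = ϑ * β ^ (q + 2) := by rw [hϑ, pow_add]; field_simp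
      _ = ϑ * κ ^ ((q + 2) * B) := by rw [← hκB, ← pow_mul, mul_comm B]
      _ ≤ ϑ * κ ^ n := mul_le_mul_of_nonneg_left
          (pow_le_pow_of_le_one hκ0.le hκ1.le h) (by linarith)
  have hwindows : ∀ s n k q : ℕ, s ≤ k * B + 1 → k * B + 1 + q * B ≤ s + n →
      ∀ w : Fin m → EuclideanSpace ℝ (Fin d),
        deviationNorm (evolve P s n w) ≤ β ^ q * deviationNorm w := by
    intro s n k q hs hn w
    refine deviationNorm_evolve_le (by positivity) (fun x => ?_) w
    refine (dispersion_evolve_le_pow hm hζ hnonneg hrow hcol hdiag hedge hconn hγ0 hs hn x).trans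
      (mul_le_mul_of_nonneg_right ?_ (dispersion_nonneg x))
    rw [← pow_mul, mul_comm q 2, pow_mul]
    exact pow_le_pow_left₀ hγ0 hγβ q
  have hdecay : ∀ s n (w : Fin m → EuclideanSpace ℝ (Fin d)),
      deviationNorm (evolve P (s + 1) n w) ≤ ϑ * κ ^ n * deviationNorm w := by
    intro s n w
    have hsB := Nat.div_add_mod s B
    have hsB' := Nat.mod_lt s hB
    have hnB := Nat.div_add_mod n B
    have hnB' := Nat.mod_lt n hB
    rw [mul_comm] at hsB hnB
    rcases h : n / B with - | q
    · rw [h] at hnB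
      have h1 := deviationNorm_evolve_le (P := P) (s := s + 1) (n := n) zero_le_one (fun x => by
        simpa using dispersion_evolve_le hnonneg hrow hcol (s + 1) n x) w
      refine h1.trans (mul_le_mul_of_nonneg_right ?_ (deviationNorm_nonneg w))
      simpa using hpow 0 n (by omega)
    · rw [h] at hnB
      refine (hwindows (s + 1) n (s / B + 1) q ?_ ?_ w).trans
        (mul_le_mul_of_nonneg_right (hpow q n ?_) (deviationNorm_nonneg w))
      all_goals
        simp only [add_mul, one_mul] at *
        omega
  intro i t ht
  obtain ⟨n, rfl⟩ := Nat.exists_eq_add_of_le' ht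
  have hinit : deviationNorm (evolve P 0 (n + 1) fun j => z j 0) ≤
      ϑ * κ ^ n * ∑ j, ‖z j 0‖ := by
    have hnB := Nat.div_add_mod n B
    have hnB' := Nat.mod_lt n hB
    rw [mul_comm] at hnB
    calc _ ≤ β ^ (n / B) * deviationNorm fun j => z j 0 :=
          hwindows 0 (n + 1) 0 (n / B) (by omega) (by omega) _
      _ ≤ ϑ * κ ^ n * deviationNorm fun j => z j 0 :=
          mul_le_mul_of_nonneg_right (hpow _ n (by rw [add_mul]; omega)) (deviationNorm_nonneg _)
      _ ≤ _ := mul_le_mul_of_nonneg_left (deviationNorm_le_sum_norm _) (by positivity)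
  have hg : ∀ t, deviationNorm (fun j => g j t) ≤ m * G_l := fun t =>
    (deviationNorm_le_sum_norm _).trans <|
      (sum_le_sum fun j _ => hgbound j t).trans_eq (by simp)
  have hgeom : ∑ k ∈ range (n + 1), κ ^ k ≤ 1 / (1 - κ) := by
    rw [geom_sum_eq hκ1.ne, ← neg_div_neg_eq, neg_sub, neg_sub]
    have := pow_pos hκ0 (n + 1)
    exact div_le_div_of_nonneg_right (by linarith) (by linarith)
  have hmain := deviationNorm_le_of_recursion (z := fun t j => z j t) (g := fun t j => g j t)
    hη.le (by linarith) hκ0.le (fun t => funext fun j => hrec j t) hg hdecay 0 (n + 1)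
  rw [zero_add] at hmain
  have hi : ‖z i (n + 1) - (1 / (m : ℝ)) • ∑ j, z j (n + 1)‖ ≤
      deviationNorm fun j => z j (n + 1) := by
    have := PiLp.norm_apply_le (WithLp.toLp 2 (deviation fun j => z j (n + 1))) i
    simpa [deviation, deviationNorm] using this
  have hnoise : η * (m * G_l) * ϑ * ∑ k ∈ range (n + 1), κ ^ k ≤
      η * (m * G_l) * ϑ * (1 / (1 - κ)) := mul_le_mul_of_nonneg_left hgeom (by positivity)
  have hslack : 0 ≤ ϑ * (2 * η * G_l) := by positivity
  calc _ ≤ ϑ * κ ^ n * ∑ j, ‖z j 0‖ + η * (m * G_l) * ϑ * (1 / (1 - κ)) := by linarith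
    _ ≤ ϑ * κ ^ n * ∑ j, ‖z j 0‖ + η * (m * G_l) * ϑ * (1 / (1 - κ)) + ϑ * (2 * η * G_l) := by
        linarith
    _ = _ := by rw [Nat.add_sub_cancel]; ring
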